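/- Let A be an A∞-algebra over a commutative ring R and let M be an A∞-bimodule over A. Then (M^{−*}, (μ*_{r,s})_{r,s≥0}) is an A∞-bimodule over A, where M^{−*} is the dual module Hom_R(M,R) with inverted grading (M^{−*})^j := Hom_R(M_{−j},R), and μ*_{r,s} : A^{⊗r}⊗M^{−*}⊗A^{⊗s} → M^{−*} is defined by (μ*_{r,s}(a_1,…,a_r,m*,a_{r+1},…,a_{r+s}))(m) := (−1)^{‡_{r,s}} m*(μ^M_{s,r}(a_{r+1},…,a_{r+s},m,a_1,…,a_r)) with ‡_{r,s} := ✠_1^r·(✠_{r+1}^{r+s}+μ_{M*}(m*)+μ_M(m)) + μ_{M*}(m*)+1, where μ_{M*}(m*) is the degree of m* in M^{−*}. -/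

import Mathlib

namespace AInfPaper

open Finset
open scoped TensorProduct

attribute [local instance 2000] AddCommGroup.toAddCommMonoid

/-- The sign `(-1)^k` for `k : ℤ`. -/
def sgn (k : ℤ) : ℤ := (-1) ^ k.natAbs

section

variable (R : Type) [CommRing R]

/-- `R`-multilinearity of an `n`-ary map between modules. -/
def IsMultilinear {A B : Type} [AddCommGroup A] [Module R A] [AddCommGroup B] [Module R B]
    {n : ℕ} (g : (Fin n → A) → B) : Prop :=
  (∀ (v : Fin n → A) (i : Fin n) (x y : A),
      g (Function.update v i (x + y)) = g (Function.update v i x) + g (Function.update v i y)) ∧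
  (∀ (v : Fin n → A) (i : Fin n) (c : R) (x : A),
      g (Function.update v i (c • x)) = c • g (Function.update v i x))

/-- `R`-linearity in every slot of a map `A^{⊗r} ⊗ M ⊗ A^{⊗s} → N`. -/
def IsTriMultilinear {A M N : Type} [AddCommGroup A] [Module R A] [AddCommGroup M] [Module R M]
    [AddCommGroup N] [Module R N] {r s : ℕ}
    (g : (Fin r → A) → M → (Fin s → A) → N) : Prop :=
  (∀ (x : Fin r → A) (m : M) (y : Fin s → A) (i : Fin r) (v w : A),
      g (Function.update x i (v + w)) m y
        = g (Function.update x i v) m y + g (Function.update x i w) m y) ∧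
  (∀ (x : Fin r → A) (m : M) (y : Fin s → A) (i : Fin r) (c : R) (v : A),
      g (Function.update x i (c • v)) m y = c • g (Function.update x i v) m y) ∧
  (∀ (x : Fin r → A) (m₁ m₂ : M) (y : Fin s → A), g x (m₁ + m₂) y = g x m₁ y + g x m₂ y) ∧
  (∀ (x : Fin r → A) (c : R) (m : M) (y : Fin s → A), g x (c • m) y = c • g x m y) ∧
  (∀ (x : Fin r → A) (m : M) (y : Fin s → A) (j : Fin s) (v w : A),
      g x m (Function.update y j (v + w))
        = g x m (Function.update y j v) + g x m (Function.update y j w)) ∧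
  (∀ (x : Fin r → A) (m : M) (y : Fin s → A) (j : Fin s) (c : R) (v : A),
      g x m (Function.update y j (c • v)) = c • g x m (Function.update y j v))

/-- The conditions making `(gr, μ)` an `A∞`-algebra structure on `A`:
multilinearity of the operations, gradedness (`deg μₙ = 2 − n`) and the `A∞`-equations
(on homogeneous elements, with the Koszul signs `(-1)^{✠₁^{i-1}}` computed from
the reduced degrees `‖a‖ = deg a − 1`). -/
def IsAInftyAlgebra {A : Type} [AddCommGroup A] [Module R A]
    (gr : ℤ → Submodule R A) (μ : (n : ℕ) → (Fin n → A) → A) : Prop :=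
  (∀ n : ℕ, IsMultilinear R (μ n)) ∧
  (∀ (n : ℕ) (d : Fin n → ℤ) (a : Fin n → A),
      (∀ i, a i ∈ gr (d i)) → μ n a ∈ gr ((∑ i, d i) + 2 - n)) ∧
  (∀ (r : ℕ), 1 ≤ r → ∀ (d : ℕ → ℤ) (a : ℕ → A), (∀ q, q < r → a q ∈ gr (d q)) →
    ∑ n₁ ∈ Finset.Icc 1 r, ∑ i ∈ Finset.range (r + 1 - n₁),
      sgn (∑ q ∈ Finset.range i, (d q - 1)) •
        μ (r + 1 - n₁) (fun j =>
          if (j : ℕ) < i then a (j : ℕ)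
          else if (j : ℕ) = i then μ n₁ (fun k => a (i + (k : ℕ)))
          else a ((j : ℕ) + n₁ - 1)) = 0)

/-- The conditions making `(grM, μM)` an `A∞`-bimodule over the `A∞`-algebra `(gr, μ)`:
multilinearity, gradedness (`deg μM_{r,s} = 1 − r − s`) and the defining equations of
type `(r,s)` evaluated on homogeneous elements `a_1, …, a_{r+s}` (stored as `a 0, …,
a (r+s-1)` of degrees `d 0, …`) and `m` of degree `dm`. -/
def IsAInftyBimodule {A M : Type} [AddCommGroup A] [Module R A] [AddCommGroup M] [Module R M]
    (gr : ℤ → Submodule R A) (μ : (n : ℕ) → (Fin n → A) → A)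
    (grM : ℤ → Submodule R M)
    (μM : (r s : ℕ) → (Fin r → A) → M → (Fin s → A) → M) : Prop :=
  (∀ r s : ℕ, IsTriMultilinear R (μM r s)) ∧
  (∀ (r s : ℕ) (dx : Fin r → ℤ) (dm : ℤ) (dy : Fin s → ℤ)
      (x : Fin r → A) (m : M) (y : Fin s → A),
      (∀ i, x i ∈ gr (dx i)) → m ∈ grM dm → (∀ j, y j ∈ gr (dy j)) →
      μM r s x m y ∈ grM ((∑ i, dx i) + dm + (∑ j, dy j) + 1 - r - s)) ∧
  (∀ (r s : ℕ) (d : ℕ → ℤ) (dm : ℤ) (a : ℕ → A) (m : M),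
      (∀ q, q < r + s → a q ∈ gr (d q)) → m ∈ grM dm →
      (∑ r₂ ∈ Finset.Icc 1 r, ∑ i ∈ Finset.range (r + 1 - r₂),
          sgn (∑ q ∈ Finset.range i, (d q - 1)) •
            μM (r + 1 - r₂) s
              (fun j => if (j : ℕ) < i then a (j : ℕ)
                else if (j : ℕ) = i then μ r₂ (fun k => a (i + (k : ℕ)))
                else a ((j : ℕ) + r₂ - 1))
              m (fun j => a (r + (j : ℕ))))
      + (∑ r₁ ∈ Finset.range (r + 1), ∑ s₁ ∈ Finset.range (s + 1),
          sgn (∑ q ∈ Finset.range r₁, (d q - 1)) •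
            μM r₁ s₁ (fun j => a (j : ℕ))
              (μM (r - r₁) (s - s₁) (fun j => a (r₁ + (j : ℕ))) m (fun j => a (r + (j : ℕ))))
              (fun j => a (r + (s - s₁) + (j : ℕ))))
      + (∑ s₂ ∈ Finset.Icc 1 s, ∑ i ∈ Finset.range (s + 1 - s₂),
          sgn ((∑ q ∈ Finset.range (r + i), (d q - 1)) + dm) •
            μM r (s + 1 - s₂) (fun k => a (k : ℕ)) m
              (fun k => if (k : ℕ) < i then a (r + (k : ℕ))
                else if (k : ℕ) = i then μ s₂ (fun t => a (r + i + (t : ℕ)))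
                else a (r + (k : ℕ) + s₂ - 1))) = 0)

/-- The conditions making a family `f = (f_{r,s})` a morphism of `A∞`-bimodules
`M → N` over `(gr, μ)` of degree `dg`. -/
def IsBimoduleMorphism {A M N : Type} [AddCommGroup A] [Module R A] [AddCommGroup M] [Module R M]
    [AddCommGroup N] [Module R N]
    (gr : ℤ → Submodule R A) (μ : (n : ℕ) → (Fin n → A) → A)
    (grM : ℤ → Submodule R M) (μM : (r s : ℕ) → (Fin r → A) → M → (Fin s → A) → M)
    (grN : ℤ → Submodule R N) (μN : (r s : ℕ) → (Fin r → A) → N → (Fin s → A) → N)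
    (dg : ℤ)
    (f : (r s : ℕ) → (Fin r → A) → M → (Fin s → A) → N) : Prop :=
  (∀ r s : ℕ, IsTriMultilinear R (f r s)) ∧
  (∀ (r s : ℕ) (dx : Fin r → ℤ) (dm : ℤ) (dy : Fin s → ℤ)
      (x : Fin r → A) (m : M) (y : Fin s → A),
      (∀ i, x i ∈ gr (dx i)) → m ∈ grM dm → (∀ j, y j ∈ gr (dy j)) →
      f r s x m y ∈ grN ((∑ i, dx i) + dm + (∑ j, dy j) + dg - r - s)) ∧
  (∀ (r s : ℕ) (d : ℕ → ℤ) (dm : ℤ) (a : ℕ → A) (m : M),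
      (∀ q, q < r + s → a q ∈ gr (d q)) → m ∈ grM dm →
      (∑ r₁ ∈ Finset.range (r + 1), ∑ s₁ ∈ Finset.range (s + 1),
          sgn (dg * ∑ q ∈ Finset.range r₁, (d q - 1)) •
            μN r₁ s₁ (fun j => a (j : ℕ))
              (f (r - r₁) (s - s₁) (fun j => a (r₁ + (j : ℕ))) m (fun j => a (r + (j : ℕ))))
              (fun j => a (r + (s - s₁) + (j : ℕ))))
      = (∑ r₂ ∈ Finset.Icc 1 r, ∑ i ∈ Finset.range (r + 1 - r₂),
          sgn ((∑ q ∈ Finset.range i, (d q - 1)) + dg) •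
            f (r + 1 - r₂) s
              (fun j => if (j : ℕ) < i then a (j : ℕ)
                else if (j : ℕ) = i then μ r₂ (fun k => a (i + (k : ℕ)))
                else a ((j : ℕ) + r₂ - 1))
              m (fun j => a (r + (j : ℕ))))
      + (∑ r₁ ∈ Finset.range (r + 1), ∑ s₁ ∈ Finset.range (s + 1),
          sgn ((∑ q ∈ Finset.range r₁, (d q - 1)) + dg) •
            f r₁ s₁ (fun j => a (j : ℕ))
              (μM (r - r₁) (s - s₁) (fun j => a (r₁ + (j : ℕ))) m (fun j => a (r + (j : ℕ))))
              (fun j => a (r + (s - s₁) + (j : ℕ))))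
      + (∑ s₂ ∈ Finset.Icc 1 s, ∑ i ∈ Finset.range (s + 1 - s₂),
          sgn ((∑ q ∈ Finset.range (r + i), (d q - 1)) + dm + dg) •
            f r (s + 1 - s₂) (fun k => a (k : ℕ)) m
              (fun k => if (k : ℕ) < i then a (r + (k : ℕ))
                else if (k : ℕ) = i then μ s₂ (fun t => a (r + i + (t : ℕ)))
                else a (r + (k : ℕ) + s₂ - 1))))

/-- Concatenation `(a_1,…,a_r, a₀, a_{r+1},…,a_{r+s})` of two blocks of elements
around a middle element. -/
def cat3 {A : Type} (r s : ℕ) (x : Fin r → A) (a₀ : A) (y : Fin s → A)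
    (k : Fin (r + 1 + s)) : A :=
  if h : (k : ℕ) < r then x ⟨k, h⟩
  else if h2 : (k : ℕ) = r then a₀
  else y ⟨(k : ℕ) - (r + 1), by have := k.isLt; omega⟩


/-- The `n`-th summand `M ⊗ A^{⊗n}` of the Hochschild chain complex. -/
abbrev HTens (A M : Type) [AddCommGroup A] [Module R A] [AddCommGroup M] [Module R M]
    (n : ℕ) : Type :=
  M ⊗[R] (PiTensorProduct R (fun _ : Fin n => A))

/-- The Hochschild chain module `CH_*(A;M) = ⊕ₙ M ⊗ A^{⊗n}`. -/
abbrev HChain (A M : Type) [AddCommGroup A] [Module R A] [AddCommGroup M] [Module R M] : Type :=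
  DirectSum ℕ (fun n => HTens R A M n)

/-- The elementary Hochschild chain `m ⊗ a_1 ⊗ ⋯ ⊗ a_n` (the `a`'s are `a 0, …, a (n-1)`). -/
noncomputable def hchElt {A M : Type} [AddCommGroup A] [Module R A] [AddCommGroup M] [Module R M]
    (n : ℕ) (m : M) (a : ℕ → A) : HChain R A M :=
  DirectSum.lof R ℕ (fun k => HTens R A M k) n
    (m ⊗ₜ[R] PiTensorProduct.tprod R (fun i : Fin n => a (i : ℕ)))

/-- The component `b_{i,l}` of the Hochschild differential, evaluated on the homogeneous
elementary chain `m ⊗ a_1 ⊗ ⋯ ⊗ a_n` where `m` has degree `dm` and `a_{q+1}` has degree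
`d q`.  Here `i ∈ {0,…,n}` and `l ∈ {1,…,n+1}` as in the paper; the result is an
elementary chain in `M ⊗ A^{⊗(n-l+1)}` with the appropriate Koszul sign. -/
noncomputable def bComp {A M : Type} [AddCommGroup A] [Module R A] [AddCommGroup M] [Module R M]
    (μ : (n : ℕ) → (Fin n → A) → A)
    (μM : (r s : ℕ) → (Fin r → A) → M → (Fin s → A) → M)
    (n i l : ℕ) (dm : ℤ) (d : ℕ → ℤ) (m : M) (a : ℕ → A) : HChain R A M :=
  if 1 ≤ l ∧ l ≤ n + 1 ∧ i ≤ n then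
    (if i = 0 then
      DirectSum.lof R ℕ (fun k => HTens R A M k) (n + 1 - l)
        ((μM 0 (l - 1) (fun k => a (k : ℕ)) m (fun k => a (k : ℕ))) ⊗ₜ[R]
          PiTensorProduct.tprod R (fun q : Fin (n + 1 - l) => a (l - 1 + (q : ℕ))))
    else if i + l ≤ n + 1 then
      sgn (dm + ∑ q ∈ Finset.range (i - 1), (d q - 1)) •
        DirectSum.lof R ℕ (fun k => HTens R A M k) (n + 1 - l)
          (m ⊗ₜ[R] PiTensorProduct.tprod R (fun j : Fin (n + 1 - l) =>
            if (j : ℕ) < i - 1 then a (j : ℕ)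
            else if (j : ℕ) = i - 1 then μ l (fun k => a (i - 1 + (k : ℕ)))
            else a ((j : ℕ) + l - 1)))
    else
      sgn ((dm + ∑ q ∈ Finset.range (i - 1), (d q - 1)) *
            (∑ q ∈ Finset.Ico (i - 1) n, (d q - 1))) •
        DirectSum.lof R ℕ (fun k => HTens R A M k) (n + 1 - l)
          ((μM (n - i + 1) (i + l - n - 2) (fun k => a (i - 1 + (k : ℕ))) m
              (fun k => a (k : ℕ))) ⊗ₜ[R]
            PiTensorProduct.tprod R (fun j : Fin (n + 1 - l) => a (l + i - n - 2 + (j : ℕ)))))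
  else 0

/-- `b` is the Hochschild differential of `(gr,μ,grM,μM)`: on every homogeneous elementary
chain it is given by the sum of the components `b_{i,l}`. -/
def IsHochschildB {A M : Type} [AddCommGroup A] [Module R A] [AddCommGroup M] [Module R M]
    (gr : ℤ → Submodule R A) (μ : (n : ℕ) → (Fin n → A) → A)
    (grM : ℤ → Submodule R M) (μM : (r s : ℕ) → (Fin r → A) → M → (Fin s → A) → M)
    (b : HChain R A M →ₗ[R] HChain R A M) : Prop :=
  ∀ (n : ℕ) (dm : ℤ) (d : ℕ → ℤ) (m : M) (a : ℕ → A),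
    m ∈ grM dm → (∀ q, q < n → a q ∈ gr (d q)) →
    b (hchElt R n m a)
      = ∑ l ∈ Finset.Icc 1 (n + 1), ∑ i ∈ Finset.range (n + 1),
          bComp R μ μM n i l dm d m a

/-- The degree-`j` part `CH_j(A;M)` of the Hochschild chain module: the span of the
homogeneous elementary chains `m ⊗ a_1 ⊗ ⋯ ⊗ a_n` of degree
`n − μ(m) − Σ μ(a_q) = −μ(m) − Σ ‖a_q‖ = j`. -/
noncomputable def hchDeg {A M : Type} [AddCommGroup A] [Module R A] [AddCommGroup M] [Module R M]
    (gr : ℤ → Submodule R A) (grM : ℤ → Submodule R M) (j : ℤ) :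
    Submodule R (HChain R A M) :=
  Submodule.span R {x | ∃ (n : ℕ) (dm : ℤ) (d : ℕ → ℤ) (m : M) (a : ℕ → A),
    m ∈ grM dm ∧ (∀ q, q < n → a q ∈ gr (d q)) ∧
    (-dm - ∑ q ∈ Finset.range n, (d q - 1)) = j ∧ x = hchElt R n m a}

/-- The length filtration `F_p CH_*(A;M) = ⊕_{n ≤ p} M ⊗ A^{⊗n}` (`= 0` for `p < 0`). -/
noncomputable def hchFilt {A M : Type} [AddCommGroup A] [Module R A] [AddCommGroup M] [Module R M]
    (p : ℤ) : Submodule R (HChain R A M) :=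
  ⨆ (n : ℕ) (_ : (n : ℤ) ≤ p), LinearMap.range (DirectSum.lof R ℕ (fun k => HTens R A M k) n)

/-- The length filtration indexed by `ℕ∞ = ℕ ∪ {∞}`, with `F_∞ = CH_*(A;M)`. -/
noncomputable def hchFiltE {A M : Type} [AddCommGroup A] [Module R A] [AddCommGroup M] [Module R M]
    (p : WithTop ℕ) : Submodule R (HChain R A M) :=
  ⨆ (n : ℕ) (_ : (n : WithTop ℕ) ≤ p), LinearMap.range (DirectSum.lof R ℕ (fun k => HTens R A M k) n)

/-- `b1` is the family of maps `b₁ : M ⊗ A^{⊗n} → M ⊗ A^{⊗n}` built from the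
operations with exactly one input (`μ₁` and `μM_{0,0}`). -/
def IsB1 {A M : Type} [AddCommGroup A] [Module R A] [AddCommGroup M] [Module R M]
    (gr : ℤ → Submodule R A) (μ : (n : ℕ) → (Fin n → A) → A)
    (grM : ℤ → Submodule R M) (μM : (r s : ℕ) → (Fin r → A) → M → (Fin s → A) → M)
    (b1 : (k : ℕ) → HTens R A M k →ₗ[R] HTens R A M k) : Prop :=
  ∀ (n : ℕ) (dm : ℤ) (d : ℕ → ℤ) (m : M) (a : ℕ → A),
    m ∈ grM dm → (∀ q, q < n → a q ∈ gr (d q)) →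
    DirectSum.lof R ℕ (fun k => HTens R A M k) n
        (b1 n (m ⊗ₜ[R] PiTensorProduct.tprod R (fun i : Fin n => a (i : ℕ))))
      = ∑ i ∈ Finset.range (n + 1), bComp R μ μM n i 1 dm d m a

/-- The formula for the Hochschild chain map `f_*` induced by a morphism of
`A∞`-bimodules `f = (f_{r,s}) : M → N` of degree `dg`, evaluated on a homogeneous
elementary chain. -/
noncomputable def fstarFormula {A M N : Type} [AddCommGroup A] [Module R A] [AddCommGroup M] [Module R M]
    [AddCommGroup N] [Module R N]
    (f : (r s : ℕ) → (Fin r → A) → M → (Fin s → A) → N) (dg : ℤ)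
    (n : ℕ) (dm : ℤ) (d : ℕ → ℤ) (m : M) (a : ℕ → A) : HChain R A N :=
  ∑ r ∈ Finset.range (n + 1), ∑ s ∈ Finset.range (n + 1 - r),
    sgn ((dm + ∑ q ∈ Finset.range (n - r), (d q - 1)) * (∑ q ∈ Finset.Ico (n - r) n, (d q - 1))
          + dg * (-dm - ∑ q ∈ Finset.range n, (d q - 1))) •
      DirectSum.lof R ℕ (fun k => HTens R A N k) (n - r - s)
        ((f r s (fun k => a (n - r + (k : ℕ))) m (fun k => a (k : ℕ))) ⊗ₜ[R]
          PiTensorProduct.tprod R (fun j : Fin (n - r - s) => a (s + (j : ℕ))))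

/-- `F` is the Hochschild chain map induced by `f`. -/
def IsFStar {A M N : Type} [AddCommGroup A] [Module R A] [AddCommGroup M] [Module R M]
    [AddCommGroup N] [Module R N]
    (gr : ℤ → Submodule R A) (grM : ℤ → Submodule R M)
    (f : (r s : ℕ) → (Fin r → A) → M → (Fin s → A) → N) (dg : ℤ)
    (F : HChain R A M →ₗ[R] HChain R A N) : Prop :=
  ∀ (n : ℕ) (dm : ℤ) (d : ℕ → ℤ) (m : M) (a : ℕ → A),
    m ∈ grM dm → (∀ q, q < n → a q ∈ gr (d q)) →
    F (hchElt R n m a) = fstarFormula R f dg n dm d m a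


/-- The degree-`j` part of the graded dual of a graded module: those functionals which
vanish on `grV i` for every `i ≠ j`. -/
def dualGrade {V : Type} [AddCommMonoid V] [Module R V]
    (grV : ℤ → Submodule R V) (j : ℤ) : Submodule R (Module.Dual R V) where
  carrier := {φ | ∀ i : ℤ, i ≠ j → ∀ v ∈ grV i, φ v = 0}
  add_mem' := by
    intro φ ψ hφ hψ i hi v hv
    simp [hφ i hi v hv, hψ i hi v hv]
  zero_mem' := by intro i hi v hv; simp
  smul_mem' := by
    intro c φ hφ i hi v hv
    simp [hφ i hi v hv]

/-- `μStar` is the family of structure maps of the dual `A∞`-bimodule `M^{-*}`: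
tri-multilinear maps which, on homogeneous elements, are given by Tradler's formula with
the sign `(-1)^{‡_{r,s}}`.  Here a functional of degree `k` in `M^{-*}` is one that
vanishes on `grM i` for `i ≠ -k`. -/
def IsDualOps {A M : Type} [AddCommGroup A] [Module R A] [AddCommGroup M] [Module R M]
    (gr : ℤ → Submodule R A) (grM : ℤ → Submodule R M)
    (μM : (r s : ℕ) → (Fin r → A) → M → (Fin s → A) → M)
    (μStar : (r s : ℕ) → (Fin r → A) → Module.Dual R M → (Fin s → A) → Module.Dual R M) :
    Prop :=
  (∀ r s : ℕ, IsTriMultilinear R (μStar r s)) ∧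
  (∀ (r s : ℕ) (dx : Fin r → ℤ) (k : ℤ) (dy : Fin s → ℤ) (dm : ℤ)
      (x : Fin r → A) (φ : Module.Dual R M) (y : Fin s → A) (m : M),
      (∀ i, x i ∈ gr (dx i)) → φ ∈ dualGrade R grM (-k) → (∀ j, y j ∈ gr (dy j)) →
      m ∈ grM dm →
      μStar r s x φ y m
        = sgn (((∑ i, dx i) - r) * (((∑ j, dy j) - s) + k + dm) + k + 1) •
            φ (μM s r y m x))

/-- The Hochschild cochain module `CH^*(A;P) = Πₙ Hom(A^{⊗n}, P)`, with `Hom(A^{⊗n},P)`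
realized as `n`-multilinear maps. -/
abbrev HCochain (A P : Type) [AddCommGroup A] [Module R A] [AddCommGroup P] [Module R P] :
    Type :=
  (n : ℕ) → MultilinearMap R (fun _ : Fin n => A) P

/-- The degree-`j` part `CH^j(A;P) = Πₙ Hom^{j-n}(A^{⊗n},P)` of the Hochschild cochain
module. -/
def ccDeg {A P : Type} [AddCommGroup A] [Module R A] [AddCommGroup P] [Module R P]
    (gr : ℤ → Submodule R A) (grP : ℤ → Submodule R P) (j : ℤ) :
    Submodule R (HCochain R A P) where
  carrier := {c | ∀ (n : ℕ) (dFin : Fin n → ℤ) (a : Fin n → A),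
      (∀ i, a i ∈ gr (dFin i)) → c n a ∈ grP ((∑ i, dFin i) + (j - n))}
  add_mem' := by
    intro c c' hc hc' n dFin a ha
    have h : (c + c') n a = c n a + c' n a := rfl
    rw [h]
    exact (grP _).add_mem (hc n dFin a ha) (hc' n dFin a ha)
  zero_mem' := by
    intro n dFin a ha
    have h : (0 : HCochain R A P) n a = 0 := rfl
    rw [h]
    exact (grP _).zero_mem
  smul_mem' := by
    intro t c hc n dFin a ha
    have h : (t • c) n a = t • c n a := rfl
    rw [h]
    exact (grP _).smul_mem t (hc n dFin a ha)

/-- `β` is the Hochschild codifferential on `CH^*(A;P)` for the coefficient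
`A∞`-bimodule `(grP, μP)`: its value on a cochain which is homogeneous of degree `j` is
given componentwise on homogeneous elements by the defining formula. -/
def IsCodiff {A P : Type} [AddCommGroup A] [Module R A] [AddCommGroup P] [Module R P]
    (gr : ℤ → Submodule R A) (μ : (n : ℕ) → (Fin n → A) → A)
    (grP : ℤ → Submodule R P)
    (μP : (r s : ℕ) → (Fin r → A) → P → (Fin s → A) → P)
    (β : HCochain R A P →ₗ[R] HCochain R A P) : Prop :=
  ∀ (c : HCochain R A P) (j : ℤ),
    (∀ (n : ℕ) (dFin : Fin n → ℤ) (a : Fin n → A), (∀ i, a i ∈ gr (dFin i)) →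
        c n a ∈ grP ((∑ i, dFin i) + (j - n))) →
    ∀ (L : ℕ) (d : ℕ → ℤ) (a : ℕ → A), (∀ q, q < L → a q ∈ gr (d q)) →
      β c L (fun i : Fin L => a (i : ℕ))
        = ∑ l ∈ Finset.range (L + 1),
            ((∑ i ∈ Finset.range (L - l),
                sgn (∑ q ∈ Finset.range i, (d q - 1)) •
                  c (L - l) (fun t : Fin (L - l) =>
                    if (t : ℕ) < i then a (t : ℕ)
                    else if (t : ℕ) = i then μ (l + 1) (fun k => a (i + (k : ℕ)))
                    else a ((t : ℕ) + l)))
              + ∑ i ∈ Finset.range (l + 1),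
                  sgn (j * ((∑ q ∈ Finset.range i, (d q - 1)) + 1) + 1) •
                    μP i (l - i) (fun k => a (k : ℕ))
                      (c (L - l) (fun k : Fin (L - l) => a (i + (k : ℕ))))
                      (fun k => a ((L - l) + i + (k : ℕ))))


/-- `Φ` is the duality map `φ : Hom(CH_*(A;M),R) → CH^*(A;M^{-*})`, characterized on
homogeneous elements by `(φ(g)(a_1,…,a_n))(m) = (-1)^{μ(m)·✠₁ⁿ} g(m ⊗ a_1 ⊗ ⋯ ⊗ a_n)`. -/
def IsPhi {A M : Type} [AddCommGroup A] [Module R A] [AddCommGroup M] [Module R M]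
    (gr : ℤ → Submodule R A) (grM : ℤ → Submodule R M)
    (Φ : Module.Dual R (HChain R A M) →ₗ[R] HCochain R A (Module.Dual R M)) : Prop :=
  ∀ (g : Module.Dual R (HChain R A M)) (n : ℕ) (dm : ℤ) (d : ℕ → ℤ) (m : M) (a : ℕ → A),
    m ∈ grM dm → (∀ q, q < n → a q ∈ gr (d q)) →
    Φ g n (fun i : Fin n => a (i : ℕ)) m
      = sgn (dm * ∑ q ∈ Finset.range n, (d q - 1)) • g (hchElt R n m a)

end

section Tagged

variable {A M : Type} [AddCommGroup A] [AddCommGroup M]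

/-- A degree-tagged element obtained by applying `μ_l` to tagged elements. -/
def tagMu (μ : (n : ℕ) → (Fin n → A) → A) (l : ℕ) (v : Fin l → ℤ × A) : ℤ × A :=
  ((∑ i, (v i).1) + 2 - l, μ l (fun i => (v i).2))

/-- Extension of a finite tagged tuple by zero. -/
def pad {k : ℕ} (w : Fin k → ℤ × A) : ℕ → ℤ × A :=
  fun q => if h : q < k then w ⟨q, h⟩ else (0, 0)

/-- The component `(β(f))_l` of the Hochschild codifferential with coefficients in the
`A∞`-bimodule `(M, μM)`, for a (degree-tagged) cochain `f` of arity `nf` and cochain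
degree `j`, evaluated on the tagged elements `v 0, …, v (nf+l-1)`. -/
def betaT (μ : (n : ℕ) → (Fin n → A) → A)
    (μM : (r s : ℕ) → (Fin r → A) → M → (Fin s → A) → M)
    (j : ℤ) (nf : ℕ) (f : (Fin nf → ℤ × A) → M) (l : ℕ) (v : ℕ → ℤ × A) : M :=
  (∑ i ∈ Finset.range nf,
      sgn (∑ q ∈ Finset.range i, ((v q).1 - 1)) •
        f (fun t => if (t : ℕ) < i then v (t : ℕ)
            else if (t : ℕ) = i then tagMu μ (l + 1) (fun k => v (i + (k : ℕ)))
            else v ((t : ℕ) + l)))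
  + ∑ i ∈ Finset.range (l + 1),
      sgn (j * ((∑ q ∈ Finset.range i, ((v q).1 - 1)) + 1) + 1) •
        μM i (l - i) (fun k => (v (k : ℕ)).2)
          (f (fun k => v (i + (k : ℕ))))
          (fun k => (v (nf + i + (k : ℕ))).2)

/-- The component `(β(f))_l` of the Hochschild codifferential of `CH^*(A)`, i.e. with
coefficients in `A[1]` (so `μ^{A[1]}_{i-1,l-i+1} = μ_{l+1}` and the second sign uses
`deg f − 1`), for a tagged cochain `f` of arity `nf` and `CH^*(A)`-degree `j`. -/
def betaShift (μ : (n : ℕ) → (Fin n → A) → A)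
    (j : ℤ) (nf : ℕ) (f : (Fin nf → ℤ × A) → A) (l : ℕ) (v : ℕ → ℤ × A) : A :=
  (∑ i ∈ Finset.range nf,
      sgn (∑ q ∈ Finset.range i, ((v q).1 - 1)) •
        f (fun t => if (t : ℕ) < i then v (t : ℕ)
            else if (t : ℕ) = i then tagMu μ (l + 1) (fun k => v (i + (k : ℕ)))
            else v ((t : ℕ) + l)))
  + ∑ i ∈ Finset.range (l + 1),
      sgn ((j - 1) * ((∑ q ∈ Finset.range i, ((v q).1 - 1)) + 1) + 1) •
        μ (l + 1) (fun t =>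
          if (t : ℕ) < i then (v (t : ℕ)).2
          else if (t : ℕ) = i then f (fun k => v (i + (k : ℕ)))
          else (v (nf + (t : ℕ) - 1)).2)

/-- The summand `f ∪_{k,j₁,j₂} g` of the Hochschild cup product of (tagged) cochains
`f ∈ Hom(A^{⊗m},A)` of degree `jf` and `g ∈ Hom(A^{⊗n},A)` of degree `jg`, evaluated on
the tagged elements `v 0, …, v (m+n+k-1)`, with the sign `(-1)^{℧_{j₁,j₂}}`. -/
def cupT (μ : (n : ℕ) → (Fin n → A) → A) (jf jg : ℤ) (m n : ℕ)
    (f : (Fin m → ℤ × A) → A) (g : (Fin n → ℤ × A) → A)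
    (k j₁ j₂ : ℕ) (v : ℕ → ℤ × A) : A :=
  sgn ((jf - 1) * (∑ q ∈ Finset.range (j₁ - 1), ((v q).1 - 1))
       + (jg - 1) * ((∑ q ∈ Finset.range (j₂ - 1), ((v q).1 - 1)) + jf)) •
    μ (k + 2) (fun t =>
      if (t : ℕ) < j₁ - 1 then (v (t : ℕ)).2
      else if (t : ℕ) = j₁ - 1 then f (fun k' => v (j₁ - 1 + (k' : ℕ)))
      else if (t : ℕ) < j₂ - m then (v ((t : ℕ) + m - 1)).2
      else if (t : ℕ) = j₂ - m then g (fun k' => v (j₂ - 1 + (k' : ℕ)))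
      else (v ((t : ℕ) + m + n - 2)).2)

/-- The component of arity `m+n+k` of the full cup product `f ∪ g`. -/
def cupComp (μ : (n : ℕ) → (Fin n → A) → A) (jf jg : ℤ) (m n : ℕ)
    (f : (Fin m → ℤ × A) → A) (g : (Fin n → ℤ × A) → A)
    (k : ℕ) (v : ℕ → ℤ × A) : A :=
  ∑ j₁ ∈ Finset.Icc 1 (n + k), ∑ j₂ ∈ Finset.Icc (j₁ + m) (m + k + 1),
    cupT μ jf jg m n f g k j₁ j₂ v

end Tagged

section Signs

/-- The Maltese sum `✠_i^j` of the tuple `m ⊗ a_1 ⊗ ⋯` (with `μ(m) = dm`, `μ(a_{q+1}) = d q`),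
where the lower index `i ≤ 0` means that the `m`-slot is included (contributing `μ(m)`),
and the `a`-entries contribute their reduced degrees. -/
def malZ (dm : ℤ) (d : ℕ → ℤ) (i j : ℤ) : ℤ :=
  (if i ≤ 0 then dm else 0) + ∑ q ∈ Finset.Ico (i - 1).toNat j.toNat, (d q - 1)

/-- The sign exponent `*_i = ✠_0^i · ✠_{i+1}^n` of a tuple `m ⊗ a_1 ⊗ ⋯ ⊗ a_n`. -/
def starZ (dm : ℤ) (d : ℕ → ℤ) (n : ℕ) (i : ℤ) : ℤ :=
  malZ dm d 0 i * malZ dm d (i + 1) (n : ℤ)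

/-- The degree of the `M`-slot of `b_{i,l}(m ⊗ a_1 ⊗ ⋯ ⊗ a_n)`. -/
def bDm (n i l : ℕ) (dm : ℤ) (d : ℕ → ℤ) : ℤ :=
  if i = 0 then dm + (∑ q ∈ Finset.range (l - 1), d q) + 2 - l
  else if i + l ≤ n + 1 then dm
  else dm + (∑ q ∈ Finset.Ico (i - 1) n, d q) + (∑ q ∈ Finset.range (i + l - n - 2), d q) + 2 - l

/-- The degrees of the `A`-entries of `b_{i,l}(m ⊗ a_1 ⊗ ⋯ ⊗ a_n)`. -/
def bD (n i l : ℕ) (d : ℕ → ℤ) : ℕ → ℤ := fun q =>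
  if i = 0 then d (q + l - 1)
  else if i + l ≤ n + 1 then
    (if q < i - 1 then d q
     else if q = i - 1 then (∑ k ∈ Finset.range l, d (i - 1 + k)) + 2 - l
     else d (q + l - 1))
  else d (l + i - n - 2 + q)

/-- The cup-product sign exponent `℧_{j₁,j₂}(f,g,a_1,…)` for cochains of degrees
`jf` and `jg`, computed from the degrees `e q` of the inputs `a_{q+1}`. -/
def mho (jf jg : ℤ) (j₁ j₂ : ℕ) (e : ℕ → ℤ) : ℤ :=
  (jf - 1) * (∑ q ∈ Finset.range (j₁ - 1), (e q - 1))
    + (jg - 1) * ((∑ q ∈ Finset.range (j₂ - 1), (e q - 1)) + jf)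

/-- The degrees of the sequence obtained from `a_1, a_2, …` (of degrees `e 0, e 1, …`)
by replacing `a_i, …, a_{i+l}` with `μ_{l+1}(a_i,…,a_{i+l})`. -/
def insD (e : ℕ → ℤ) (i l : ℕ) : ℕ → ℤ := fun q =>
  if q < i - 1 then e q
  else if q = i - 1 then (∑ k ∈ Finset.range (l + 1), e (i - 1 + k)) + 1 - l
  else e (q + l)

end Signs

section

variable {R : Type} [CommRing R]
variable {A M : Type} [AddCommGroup A] [Module R A] [AddCommGroup M] [Module R M]

theorem sgn_eq_ite (k : ℤ) : sgn k = if Even k then 1 else -1 := by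
  unfold sgn
  split_ifs with h
  · exact Even.neg_one_pow (Int.natAbs_even.2 h)
  · exact Odd.neg_one_pow (Int.natAbs_odd.2 (Int.not_even_iff_odd.1 h))

theorem sgn_add (k l : ℤ) : sgn (k + l) = sgn k * sgn l := by
  simp only [sgn_eq_ite, Int.even_add]
  split_ifs <;> simp_all

theorem sgn_congr {k l : ℤ} (h : (k : ZMod 2) = l) : sgn k = sgn l := by
  have h2 : Even k ↔ Even l := by
    rw [← ZMod.intCast_eq_zero_iff_even, ← ZMod.intCast_eq_zero_iff_even, h]
  simp only [sgn_eq_ite, h2]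

theorem add_add_eq_of_swap {N : Type} [AddCommGroup N] {x y z x' y' z' : N}
    (h₁ : x = z') (h₂ : y = y') (h₃ : z = x') : x + y + z = x' + y' + z' := by
  rw [h₁, h₂, h₃]
  abel

/-- A sequence that starts with the entries `r, …, r + s - 1` of `f` and continues with `f`. -/
theorem exists_rotation {X : Type} (f : ℕ → X) (r s : ℕ) :
    ∃ g : ℕ → X, (∀ q < s, g q = f (r + q)) ∧ ∀ q, g (s + q) = f q :=
  ⟨fun q => if q < s then f (r + q) else f (q - s), fun _ hq => if_pos hq, fun q => by simp⟩

/-- The value of an operation depends only on the entries of its input blocks. -/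
theorem op_congr {X N P : Type} (f : (r s : ℕ) → (Fin r → X) → N → (Fin s → X) → P)
    {r r' s s' : ℕ} {x : Fin r → X} {x' : Fin r' → X} {m m' : N}
    {y : Fin s → X} {y' : Fin s' → X} (hr : r = r') (hs : s = s')
    (hx : ∀ j (h : j < r) (h' : j < r'), x ⟨j, h⟩ = x' ⟨j, h'⟩) (hm : m = m')
    (hy : ∀ j (h : j < s) (h' : j < s'), y ⟨j, h⟩ = y' ⟨j, h'⟩) :
    f r s x m y = f r' s' x' m' y' := by
  subst hr hs hm
  congr 1
  · funext j
    exact hx j j.2 j.2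
  · funext j
    exact hy j j.2 j.2

theorem sum_fin_sub_eq (n : ℕ) (d : ℕ → ℤ) :
    (∑ i : Fin n, d i) - n = ∑ q ∈ range n, (d q - 1) := by
  rw [Fin.sum_univ_eq_sum_range, Finset.sum_sub_distrib]
  simp

theorem sum_range_sub_reverse {N : Type} [AddCommGroup N] (r s : ℕ) (F G : ℕ → ℕ → N)
    (h : ∀ p ≤ r, ∀ q ≤ s, F p q = G (s - q) (r - p)) :
    ∑ p ∈ range (r + 1), ∑ q ∈ range (s + 1), F p q
      = ∑ q ∈ range (s + 1), ∑ p ∈ range (r + 1), G q p := by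
  rw [Finset.sum_comm, ← Finset.sum_flip (fun q => ∑ p ∈ range (r + 1), G q p)]
  refine Finset.sum_congr rfl fun q hq => ?_
  rw [← Finset.sum_flip (fun p => G (s - q) p)]
  refine Finset.sum_congr rfl fun p hp => ?_
  rw [Finset.mem_range] at hp hq
  exact h p (by omega) q (by omega)

/-- Replacing `n` consecutive entries by one entry of reduced degree one more than their
total reduced degree raises the total reduced degree by one. -/
theorem sum_range_insert_sub_one (d : ℕ → ℤ) (r n i : ℕ) (hn : 1 ≤ n) (hi : i + n ≤ r) :
    ∑ j ∈ range (r + 1 - n),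
        ((if j < i then d j
          else if j = i then (∑ k : Fin n, d (i + (k : ℕ))) + 2 - n
          else d (j + n - 1)) - 1)
      = (∑ q ∈ range r, (d q - 1)) + 1 := by
  obtain ⟨t, rfl⟩ := Nat.exists_eq_add_of_le hi
  have e : i + n + t + 1 - n = i + 1 + t := by omega
  rw [e, Finset.sum_range_add, Finset.sum_range_add, Finset.sum_range_add, Finset.sum_range_add]
  have h1 : ∀ j ∈ range i,
      ((if j < i then d j
          else if j = i then (∑ k : Fin n, d (i + (k : ℕ))) + 2 - n
          else d (j + n - 1)) - 1) = d j - 1 := by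
    intro j hj
    rw [if_pos (Finset.mem_range.1 hj)]
  have h2 : ∀ j ∈ range t,
      ((if i + 1 + j < i then d (i + 1 + j)
          else if i + 1 + j = i then (∑ k : Fin n, d (i + (k : ℕ))) + 2 - n
          else d (i + 1 + j + n - 1)) - 1) = d (i + n + j) - 1 := by
    intro j _
    rw [if_neg (by omega), if_neg (by omega)]
    congr 2
    omega
  rw [Finset.sum_congr rfl h1, Finset.sum_congr rfl h2]
  have h3 := sum_fin_sub_eq n (fun k => d (i + k))
  simp only [Finset.sum_range_one, add_zero, lt_irrefl, if_false, if_true]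
  linarith

theorem insert_mem {gr : ℤ → Submodule R A} {μ : (n : ℕ) → (Fin n → A) → A}
    (hA : IsAInftyAlgebra R gr μ) {d : ℕ → ℤ} {a : ℕ → A} {r n i : ℕ}
    (hn : 1 ≤ n) (hi : i + n ≤ r) (ha : ∀ q < r, a q ∈ gr (d q)) :
    ∀ j < r + 1 - n,
      (if j < i then a j else if j = i then μ n (fun k => a (i + (k : ℕ))) else a (j + n - 1))
        ∈ gr (if j < i then d j
          else if j = i then (∑ k : Fin n, d (i + (k : ℕ))) + 2 - n
          else d (j + n - 1)) := by
  intro j hj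
  split_ifs
  · exact ha j (by omega)
  · exact hA.2.1 n (fun k => d (i + k)) _ fun k => ha _ (by omega)
  · exact ha _ (by omega)

section

variable {gr : ℤ → Submodule R A} {grM : ℤ → Submodule R M}
  {μM : (r s : ℕ) → (Fin r → A) → M → (Fin s → A) → M}
  {μStar : (r s : ℕ) → (Fin r → A) → Module.Dual R M → (Fin s → A) → Module.Dual R M}

theorem IsDualOps.apply_eq (hStar : IsDualOps R gr grM μM μStar) {r s : ℕ}
    (dx dy : ℕ → ℤ) {k dm : ℤ} (x y : ℕ → A) {φ : Module.Dual R M} {m : M}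
    (hx : ∀ q < r, x q ∈ gr (dx q)) (hφ : φ ∈ dualGrade R grM (-k))
    (hy : ∀ q < s, y q ∈ gr (dy q)) (hm : m ∈ grM dm) :
    μStar r s (fun j => x j) φ (fun j => y j) m
      = sgn ((∑ q ∈ range r, (dx q - 1)) * ((∑ q ∈ range s, (dy q - 1)) + k + dm) + k + 1) •
          φ (μM s r (fun j => y j) m (fun j => x j)) := by
  rw [hStar.2 r s (fun j => dx j) k (fun j => dy j) dm _ _ _ _ (fun i => hx i i.2) hφ
    (fun i => hy i i.2) hm, sum_fin_sub_eq, sum_fin_sub_eq]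

theorem dual_ext (hgrM : DirectSum.IsInternal grM) {φ ψ : Module.Dual R M}
    (h : ∀ i, ∀ m ∈ grM i, φ m = ψ m) : φ = ψ := by
  refine LinearMap.ext fun m => ?_
  have hm : m ∈ ⨆ i, grM i := hgrM.submodule_iSup_eq_top ▸ Submodule.mem_top
  refine Submodule.iSup_induction grM (motive := fun m => φ m = ψ m) hm h (by simp) ?_
  intro m m' e e'
  rw [map_add, map_add, e, e']

theorem IsDualOps.mem_dualGrade {μ : (n : ℕ) → (Fin n → A) → A}
    (hM : IsAInftyBimodule R gr μ grM μM) (hStar : IsDualOps R gr grM μM μStar) {r s : ℕ}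
    {dx : Fin r → ℤ} {k : ℤ} {dy : Fin s → ℤ} {x : Fin r → A} {φ : Module.Dual R M}
    {y : Fin s → A} (hx : ∀ i, x i ∈ gr (dx i)) (hφ : φ ∈ dualGrade R grM (-k))
    (hy : ∀ j, y j ∈ gr (dy j)) :
    μStar r s x φ y ∈ dualGrade R grM (-((∑ i, dx i) + k + (∑ j, dy j) + 1 - r - s)) := by
  intro i hi v hv
  rw [hStar.2 r s dx k dy i x φ y v hx hφ hy hv,
    hφ _ _ _ (hM.2.1 s r dy i dx y v x hy hv hx), smul_zero]
  intro h
  apply hi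
  linarith

theorem IsDualOps.mem_dualGrade_range {μ : (n : ℕ) → (Fin n → A) → A}
    (hM : IsAInftyBimodule R gr μ grM μM) (hStar : IsDualOps R gr grM μM μStar) {r s : ℕ}
    (dx dy : ℕ → ℤ) {k : ℤ} (x y : ℕ → A) {φ : Module.Dual R M}
    (hx : ∀ q < r, x q ∈ gr (dx q)) (hφ : φ ∈ dualGrade R grM (-k))
    (hy : ∀ q < s, y q ∈ gr (dy q)) :
    μStar r s (fun j => x j) φ (fun j => y j) ∈ dualGrade R grM
      (-((∑ q ∈ range r, (dx q - 1)) + k + (∑ q ∈ range s, (dy q - 1)) + 1)) := by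
  have h := hStar.mem_dualGrade hM (dx := fun j : Fin r => dx j) (dy := fun j : Fin s => dy j)
    (fun i => hx i i.2) hφ (fun i => hy i i.2)
  rw [← sum_fin_sub_eq, ← sum_fin_sub_eq]
  convert h using 2
  ring

theorem op_mem_range {μ : (n : ℕ) → (Fin n → A) → A}
    (hM : IsAInftyBimodule R gr μ grM μM) {r s : ℕ}
    (dx dy : ℕ → ℤ) {dm : ℤ} (x y : ℕ → A) {m : M}
    (hx : ∀ q < r, x q ∈ gr (dx q)) (hm : m ∈ grM dm) (hy : ∀ q < s, y q ∈ gr (dy q)) :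
    μM r s (fun j => x j) m (fun j => y j) ∈ grM
      ((∑ q ∈ range r, (dx q - 1)) + dm + (∑ q ∈ range s, (dy q - 1)) + 1) := by
  have h := hM.2.1 r s (fun j => dx j) dm (fun j => dy j) _ _ _
    (fun i => hx i i.2) hm (fun i => hy i i.2)
  rw [← sum_fin_sub_eq, ← sum_fin_sub_eq]
  convert h using 2
  ring

end

section Terms

variable {gr : ℤ → Submodule R A} {μ : (n : ℕ) → (Fin n → A) → A} {grM : ℤ → Submodule R M}
  {μM : (r s : ℕ) → (Fin r → A) → M → (Fin s → A) → M}
  {μStar : (r s : ℕ) → (Fin r → A) → Module.Dual R M → (Fin s → A) → Module.Dual R M}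

/-- Dualizing an operation whose left block contains an inserted `μ_n`. -/
theorem IsDualOps.left_insert (hA : IsAInftyAlgebra R gr μ)
    (hStar : IsDualOps R gr grM μM μStar) {r s n i : ℕ} {d : ℕ → ℤ} {a : ℕ → A} {k dm : ℤ}
    {φ : Module.Dual R M} {m : M} (ha : ∀ q < r + s, a q ∈ gr (d q))
    (hφ : φ ∈ dualGrade R grM (-k)) (hm : m ∈ grM dm) (hn : 1 ≤ n) (hi : i + n ≤ r) :
    sgn (∑ q ∈ range i, (d q - 1)) •
        μStar (r + 1 - n) s
          (fun j => if (j : ℕ) < i then a (j : ℕ)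
            else if (j : ℕ) = i then μ n (fun k => a (i + (k : ℕ)))
            else a ((j : ℕ) + n - 1))
          φ (fun j => a (r + (j : ℕ))) m
      = sgn ((∑ q ∈ range r, (d q - 1)) * ((∑ q ∈ range s, (d (r + q) - 1)) + k + dm) + 1) •
        sgn ((∑ q ∈ range s, (d (r + q) - 1)) + (∑ q ∈ range i, (d q - 1)) + dm) •
          φ (μM s (r + 1 - n) (fun j => a (r + (j : ℕ))) m
            (fun j => if (j : ℕ) < i then a (j : ℕ)
              else if (j : ℕ) = i then μ n (fun k => a (i + (k : ℕ)))
              else a ((j : ℕ) + n - 1))) := by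
  have h := hStar.apply_eq (r := r + 1 - n) (s := s) _ (fun q => d (r + q)) _
    (fun q => a (r + q)) (insert_mem hA hn hi fun q hq => ha q (by omega)) hφ
    (fun q hq => ha _ (by omega)) hm
  rw [sum_range_insert_sub_one d r n i hn hi] at h
  rw [h, smul_smul, smul_smul, ← sgn_add, ← sgn_add]
  congr 1
  apply sgn_congr
  push_cast
  generalize ((∑ q ∈ range i, ((d q : ZMod 2) - 1))) = u
  generalize ((∑ q ∈ range r, ((d q : ZMod 2) - 1))) = α
  generalize ((∑ q ∈ range s, ((d (r + q) : ZMod 2) - 1))) = β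
  generalize (k : ZMod 2) = k
  generalize (dm : ZMod 2) = dm
  revert u α β k dm
  decide

/-- Dualizing an operation whose right block contains an inserted `μ_n`. -/
theorem IsDualOps.right_insert (hA : IsAInftyAlgebra R gr μ)
    (hStar : IsDualOps R gr grM μM μStar) {r s n i : ℕ} {d : ℕ → ℤ} {a : ℕ → A} {k dm : ℤ}
    {φ : Module.Dual R M} {m : M} (ha : ∀ q < r + s, a q ∈ gr (d q))
    (hφ : φ ∈ dualGrade R grM (-k)) (hm : m ∈ grM dm) (hn : 1 ≤ n) (hi : i + n ≤ s) :
    sgn ((∑ q ∈ range (r + i), (d q - 1)) + k) •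
        μStar r (s + 1 - n) (fun j => a (j : ℕ)) φ
          (fun j => if (j : ℕ) < i then a (r + (j : ℕ))
            else if (j : ℕ) = i then μ n (fun k => a (r + (i + (k : ℕ))))
            else a (r + ((j : ℕ) + n - 1))) m
      = sgn ((∑ q ∈ range r, (d q - 1)) * ((∑ q ∈ range s, (d (r + q) - 1)) + k + dm) + 1) •
        sgn (∑ q ∈ range i, (d (r + q) - 1)) •
          φ (μM (s + 1 - n) r
            (fun j => if (j : ℕ) < i then a (r + (j : ℕ))
              else if (j : ℕ) = i then μ n (fun k => a (r + (i + (k : ℕ))))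
              else a (r + ((j : ℕ) + n - 1)))
            m (fun j => a (j : ℕ))) := by
  have h := hStar.apply_eq (r := r) (s := s + 1 - n) d _ a _
    (fun q hq => ha _ (by omega)) hφ
    (insert_mem (d := fun q => d (r + q)) (a := fun q => a (r + q)) hA hn hi
      fun q hq => ha _ (by omega)) hm
  rw [sum_range_insert_sub_one (fun q => d (r + q)) s n i hn hi] at h
  rw [h, smul_smul, smul_smul, ← sgn_add, ← sgn_add, Finset.sum_range_add]
  congr 1
  apply sgn_congr
  push_cast
  generalize ((∑ q ∈ range i, ((d (r + q) : ZMod 2) - 1))) = u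
  generalize ((∑ q ∈ range r, ((d q : ZMod 2) - 1))) = α
  generalize ((∑ q ∈ range s, ((d (r + q) : ZMod 2) - 1))) = β
  generalize (k : ZMod 2) = k
  generalize (dm : ZMod 2) = dm
  revert u α β k dm
  decide

/-- Dualizing a composition of two bimodule operations. -/
theorem IsDualOps.comp (hM : IsAInftyBimodule R gr μ grM μM)
    (hStar : IsDualOps R gr grM μM μStar) {r₁ r₂ s₁ s₂ : ℕ} {d : ℕ → ℤ} {a : ℕ → A} {k dm : ℤ}
    {φ : Module.Dual R M} {m : M} (ha : ∀ q < r₁ + r₂ + (s₂ + s₁), a q ∈ gr (d q))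
    (hφ : φ ∈ dualGrade R grM (-k)) (hm : m ∈ grM dm) :
    sgn (∑ q ∈ range r₁, (d q - 1)) •
        μStar r₁ s₁ (fun j => a (j : ℕ))
          (μStar r₂ s₂ (fun j => a (r₁ + (j : ℕ))) φ (fun j => a (r₁ + r₂ + (j : ℕ))))
          (fun j => a (r₁ + r₂ + s₂ + (j : ℕ))) m
      = sgn ((∑ q ∈ range (r₁ + r₂), (d q - 1)) *
            ((∑ q ∈ range (s₂ + s₁), (d (r₁ + r₂ + q) - 1)) + k + dm) + 1) •
        sgn (∑ q ∈ range s₂, (d (r₁ + r₂ + q) - 1)) •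
          φ (μM s₂ r₂ (fun j => a (r₁ + r₂ + (j : ℕ)))
            (μM s₁ r₁ (fun j => a (r₁ + r₂ + s₂ + (j : ℕ))) m (fun j => a (j : ℕ)))
            (fun j => a (r₁ + (j : ℕ)))) := by
  have hψ := hStar.mem_dualGrade_range (r := r₂) (s := s₂) hM (fun q => d (r₁ + q))
    (fun q => d (r₁ + r₂ + q)) (fun q => a (r₁ + q)) (fun q => a (r₁ + r₂ + q))
    (fun q hq => ha _ (by omega)) hφ (fun q hq => ha _ (by omega))
  have hm' := op_mem_range (r := s₁) (s := r₁) hM (fun q => d (r₁ + r₂ + s₂ + q)) d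
    (fun q => a (r₁ + r₂ + s₂ + q)) a (fun q hq => ha _ (by omega)) hm
    (fun q hq => ha _ (by omega))
  rw [hStar.apply_eq (r := r₁) (s := s₁) d (fun q => d (r₁ + r₂ + s₂ + q)) a
      (fun q => a (r₁ + r₂ + s₂ + q)) (fun q hq => ha _ (by omega)) hψ
      (fun q hq => ha _ (by omega)) hm,
    hStar.apply_eq (r := r₂) (s := s₂) (fun q => d (r₁ + q))
      (fun q => d (r₁ + r₂ + q)) (fun q => a (r₁ + q)) (fun q => a (r₁ + r₂ + q))
      (fun q hq => ha _ (by omega)) hφ (fun q hq => ha _ (by omega)) hm',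
    smul_smul, smul_smul, smul_smul, ← sgn_add, ← sgn_add, ← sgn_add,
    Finset.sum_range_add _ r₁, Finset.sum_range_add _ s₂]
  congr 1
  apply sgn_congr
  simp only [← add_assoc]
  push_cast
  generalize ((∑ q ∈ range r₁, ((d q : ZMod 2) - 1))) = α₁
  generalize ((∑ q ∈ range r₂, ((d (r₁ + q) : ZMod 2) - 1))) = α₂
  generalize ((∑ q ∈ range s₂, ((d (r₁ + r₂ + q) : ZMod 2) - 1))) = β₁
  generalize ((∑ q ∈ range s₁, ((d (r₁ + r₂ + s₂ + q) : ZMod 2) - 1))) = β₂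
  generalize (k : ZMod 2) = k
  generalize (dm : ZMod 2) = dm
  revert α₁ α₂ β₁ β₂ k dm
  decide

end Terms

end

section

variable (R : Type) [CommRing R]

/-- Theorem 1.10 of the paper, after Tradler.  Let `A` be an
`A∞`-algebra over `R` and `M` an `A∞`-bimodule over `A`.  Then the dual module
`M^{-*} = Hom_R(M,R)` with inverted grading (`(M^{-*})^j = Hom_R(M_{-j},R)`), equipped
with the dual operations `μ*_{r,s}` characterized on homogeneous elements by
`(μ*_{r,s}(a_1,…,a_r,m*,a_{r+1},…,a_{r+s}))(m)
   = (-1)^{‡_{r,s}} m*(μ^M_{s,r}(a_{r+1},…,a_{r+s},m,a_1,…,a_r))`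
with `‡_{r,s} = ✠₁ʳ·(✠_{r+1}^{r+s} + μ(m*) + μ(m)) + μ(m*) + 1`,
is an `A∞`-bimodule over `A`. -/
theorem dual_is_bimodule
    {A M : Type} [AddCommGroup A] [Module R A] [AddCommGroup M] [Module R M]
    (gr : ℤ → Submodule R A) (μ : (n : ℕ) → (Fin n → A) → A)
    (grM : ℤ → Submodule R M) (μM : (r s : ℕ) → (Fin r → A) → M → (Fin s → A) → M)
    (hA : IsAInftyAlgebra R gr μ) (hM : IsAInftyBimodule R gr μ grM μM)
    (hgr : DirectSum.IsInternal gr) (hgrM : DirectSum.IsInternal grM)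
    (μStar : (r s : ℕ) → (Fin r → A) → Module.Dual R M → (Fin s → A) → Module.Dual R M)
    (hStar : IsDualOps R gr grM μM μStar) :
    IsAInftyBimodule R gr μ (fun j => dualGrade R grM (-j)) μStar := by
  refine ⟨hStar.1, fun r s dx k dy x φ y hx hφ hy => hStar.mem_dualGrade hM hx hφ hy, ?_⟩
  intro r s d k a φ ha hφ
  refine dual_ext hgrM fun dm m hm => ?_
  obtain ⟨a', ha₁, ha₂⟩ := exists_rotation a r s
  obtain ⟨d', hd₁, hd₂⟩ := exists_rotation d r s
  have ha' : ∀ q < s + r, a' q ∈ gr (d' q) := by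
    intro q hq
    by_cases h : q < s
    · rw [ha₁ q h, hd₁ q h]
      exact ha _ (by omega)
    · obtain ⟨t, rfl⟩ := Nat.exists_eq_add_of_le (not_lt.1 h)
      rw [ha₂, hd₂]
      exact ha _ (by omega)
  have hdeg : ∀ n ≤ s, ∑ q ∈ range n, (d' q - 1) = ∑ q ∈ range n, (d (r + q) - 1) :=
    fun n hn => Finset.sum_congr rfl fun q hq => by
      rw [hd₁ q (lt_of_lt_of_le (Finset.mem_range.1 hq) hn)]
  have hrot := congrArg (fun z => sgn ((∑ q ∈ range r, (d q - 1)) *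
    ((∑ q ∈ range s, (d (r + q) - 1)) + k + dm) + 1) • φ z) (hM.2.2 s r d' dm a' m ha' hm)
  simp only [map_zero, smul_zero] at hrot
  rw [LinearMap.zero_apply, ← hrot]
  simp only [LinearMap.add_apply, LinearMap.sum_apply, LinearMap.smul_apply, map_add, map_sum,
    map_zsmul, smul_add, Finset.smul_sum]
  apply add_add_eq_of_swap
  · refine Finset.sum_congr rfl fun n hn => Finset.sum_congr rfl fun i hi => ?_
    rw [Finset.mem_Icc] at hn
    rw [Finset.mem_range] at hi
    rw [hStar.left_insert hA ha hφ hm hn.1 (by omega), Finset.sum_range_add, hdeg s le_rfl]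
    simp only [add_assoc, hd₂, ha₂]
    congr 3
    refine op_congr μM rfl rfl (fun j hj _ => (ha₁ j hj).symm) rfl fun j hj _ => ?_
    dsimp only
    split_ifs
    · rfl
    · rfl
    · rw [← ha₂]
      congr 1
      omega
  · refine sum_range_sub_reverse r s _ _ fun p hp q hq => ?_
    obtain ⟨p', rfl⟩ := Nat.exists_eq_add_of_le hp
    obtain ⟨q', rfl⟩ := Nat.exists_eq_add_of_le' hq
    have e₁ : p + p' - p = p' := by omega
    have e₂ : q' + q - q = q' := by omega
    refine Eq.trans ?_ ((hStar.comp hM (r₁ := p) (r₂ := p') (s₁ := q) (s₂ := q')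
      ha hφ hm).trans ?_)
    · congr 2
      refine op_congr μStar rfl rfl (fun j _ _ => rfl) ?_ fun j _ _ => by simp only [e₂]
      exact op_congr μStar e₁ e₂ (fun j _ _ => rfl) rfl fun j _ _ => rfl
    · rw [hdeg _ (by omega)]
      simp only [e₂]
      congr 3
      refine op_congr μM e₂.symm e₁.symm (fun j _ _ => (ha₁ j (by omega)).symm) ?_ fun j _ _ => ?_
      · refine op_congr μM (by omega) (by omega) (fun j _ _ => ?_) rfl fun j _ _ => (ha₂ j).symm
        dsimp only
        rw [ha₁ _ (by omega), add_assoc (p + p')]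
      · dsimp only
        rw [add_assoc, ha₂]
        congr 1
        omega
  · refine Finset.sum_congr rfl fun n hn => Finset.sum_congr rfl fun i hi => ?_
    rw [Finset.mem_Icc] at hn
    rw [Finset.mem_range] at hi
    have h := hStar.right_insert hA ha hφ hm hn.1 (show i + n ≤ s by omega)
    rw [hdeg i (by omega)]
    refine Eq.trans ?_ (h.trans ?_)
    · congr 2
      refine op_congr μStar rfl rfl (fun j hj _ => rfl) rfl fun j hj _ => ?_
      simp only [add_assoc]
      split_ifs
      · rfl
      · rfl
      · congr 1
        omega
    · congr 3
      refine op_congr μM rfl rfl (fun j hj _ => ?_) rfl fun j hj _ => (ha₂ j).symm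
      dsimp only
      split_ifs
      · exact (ha₁ _ (by omega)).symm
      · congr 1
        funext t
        exact (ha₁ _ (by omega)).symm
      · exact (ha₁ _ (by omega)).symm

end

end AInfPaper
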